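/- arXiv:1612.09179 — 5 statements merged into one kernel-verified Lean document; each statement's English description precedes it below -/
import Mathlib

section
/- Let C be an infinite compact metric space that admits a topological embedding into ℝ^d for some d ∈ ℕ, let h : C → C be a minimal homeomorphism, and let X be the suspension space of h. Then X is a nondegenerate compact connected metrizable space and there exists a continuous surjection f : X → X that is minimal and not injective. -/
open Function Set Topology Filter Metric

/-- A continuous map is minimal if every forward orbit `{f^n x : n ≥ 1}` is dense. -/
def IsMinimalMap {X : Type*} [TopologicalSpace X] (f : X → X) : Prop :=
  Continuous f ∧ ∀ x : X, Dense (Set.range fun n : ℕ => f^[n + 1] x)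

/-- A space admits a minimal homeomorphism. -/
def AdmitsMinimalHomeo (X : Type*) [TopologicalSpace X] : Prop :=
  ∃ h : X ≃ₜ X, IsMinimalMap (h : X → X)

/-- Factor map between dynamical systems. -/
def IsFactorMap {X Y : Type*} [TopologicalSpace X] [TopologicalSpace Y]
    (π : X → Y) (f : X → X) (g : Y → Y) : Prop :=
  Continuous π ∧ Function.Surjective π ∧ π ∘ f = g ∘ π

/-- A map is almost 1-1 if the set of points with singleton fiber is dense. -/
def IsAlmostOneOne {X Y : Type*} [TopologicalSpace X] [TopologicalSpace Y] (π : X → Y) : Prop :=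
  Dense {y : Y | ∃! x : X, π x = y}

/-- The identification relation for the suspension of a homeomorphism `h`:
`(x, y) ∼ (p, q)` iff `y - q ∈ ℤ` and `p = h^(q - y) x`. -/
def suspRel {C : Type*} [TopologicalSpace C] (h : C ≃ₜ C) : C × ℝ → C × ℝ → Prop :=
  fun a b => ∃ n : ℤ, a.2 - b.2 = (n : ℝ) ∧ b.1 = (h.toEquiv ^ (-n)) a.1

/-- The suspension space of a homeomorphism `h : C ≃ₜ C`, i.e. the quotient of
`C × ℝ` by (the equivalence relation generated by) `suspRel h`, with the quotient
topology. -/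
abbrev Susp {C : Type*} [TopologicalSpace C] (h : C ≃ₜ C) : Type _ :=
  Quot (suspRel h)

section JumpExtension

variable {X : Type*} [TopologicalSpace X] {ϕ : Flow ℝ X} {p : X} {R : Set (X × ℝ)} {t : ℝ}

/-- `R` is the filled graph of a function `X → [0, 1]` whose only discontinuity is a jump at `p`,
and which decreases along the flow lines of `ϕ` with speed at most `2`. -/
structure IsFlowJump (ϕ : Flow ℝ X) (p : X) (R : Set (X × ℝ)) : Prop where
  isClosed : IsClosed R
  mem_Icc : ∀ {z v}, (z, v) ∈ R → v ∈ Icc (0 : ℝ) 1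
  nonempty : ∀ z, ∃ v, (z, v) ∈ R
  full : ∀ {v}, v ∈ Icc (0 : ℝ) 1 → (p, v) ∈ R
  unique : ∀ {z v w}, z ≠ p → (z, v) ∈ R → (z, w) ∈ R → v = w
  slope : ∀ {z v w a}, 0 < a → (z, v) ∈ R → (ϕ a z, w) ∈ R → v - 2 * a ≤ w

/-- The extension of the time-`t` map of `ϕ` recording the values of the jump function
along the forward orbit. -/
def jumpExtension (ϕ : Flow ℝ X) (R : Set (X × ℝ)) (t : ℝ) : Set (X × (ℕ → ℝ)) :=
  {k | ∀ j : ℕ, (ϕ (j * t) k.1, k.2 j) ∈ R}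

/-- The total displacement attached to a sequence of jump values. -/
noncomputable def jumpShift (v : ℕ → ℝ) : ℝ := ∑' j, (1 / 2 : ℝ) ^ j * v j

/-- The flow moves each point of the extension by (a fraction of) its total displacement. -/
noncomputable def jumpCollapse (ϕ : Flow ℝ X) (R : Set (X × ℝ)) (t : ℝ)
    (k : jumpExtension ϕ R t) : X :=
  ϕ (jumpShift k.1.2 / 8) k.1.1

/-- The shift map on the extension, lifting the time-`t` map. -/
def jumpMap (ϕ : Flow ℝ X) (R : Set (X × ℝ)) (t : ℝ) (k : jumpExtension ϕ R t) :
    jumpExtension ϕ R t :=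
  ⟨(ϕ t k.1.1, fun j => k.1.2 (j + 1)), fun j => by
    have := k.2 (j + 1)
    rw [← ϕ.map_add]
    convert this using 3
    push_cast
    ring⟩

theorem summable_jump {v : ℕ → ℝ} (hv : ∀ j, v j ∈ Icc (0 : ℝ) 1) :
    Summable fun j => (1 / 2 : ℝ) ^ j * v j :=
  Summable.of_nonneg_of_le (fun j => mul_nonneg (by positivity) (hv j).1)
    (fun j => mul_le_of_le_one_right (by positivity) (hv j).2) summable_geometric_two

theorem jumpShift_mem_Icc {v : ℕ → ℝ} (hv : ∀ j, v j ∈ Icc (0 : ℝ) 1) :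
    jumpShift v ∈ Icc (0 : ℝ) 2 := by
  refine ⟨tsum_nonneg fun j => mul_nonneg (by positivity) (hv j).1, ?_⟩
  rw [← tsum_geometric_two]
  exact (summable_jump hv).tsum_le_tsum
    (fun j => mul_le_of_le_one_right (by positivity) (hv j).2) summable_geometric_two

namespace IsFlowJump

theorem seq_mem_Icc (hR : IsFlowJump ϕ p R) {k : X × (ℕ → ℝ)} (hk : k ∈ jumpExtension ϕ R t)
    (j : ℕ) : k.2 j ∈ Icc (0 : ℝ) 1 :=
  hR.mem_Icc (hk j)

theorem isClosed_jumpExtension (hR : IsFlowJump ϕ p R) : IsClosed (jumpExtension ϕ R t) := by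
  simp only [jumpExtension, ofPred_forall]
  refine isClosed_iInter fun j => hR.isClosed.preimage ?_
  exact (ϕ.continuous continuous_const continuous_fst).prodMk
    ((continuous_apply j).comp continuous_snd)

theorem compactSpace_jumpExtension [CompactSpace X] (hR : IsFlowJump ϕ p R) :
    CompactSpace (jumpExtension ϕ R t) := by
  rw [← isCompact_iff_compactSpace]
  refine IsCompact.of_isClosed_subset
    (isCompact_univ.prod (isCompact_univ_pi fun _ : ℕ => isCompact_Icc (a := (0 : ℝ)) (b := 1)))
    hR.isClosed_jumpExtension fun k hk => ⟨mem_univ _, fun j _ => hR.seq_mem_Icc hk j⟩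

theorem continuous_jumpShift (hR : IsFlowJump ϕ p R) :
    Continuous fun k : jumpExtension ϕ R t => jumpShift k.1.2 := by
  refine continuous_tsum (u := fun j => (1 / 2 : ℝ) ^ j) (fun j => ?_) summable_geometric_two
    fun j k => ?_
  · exact continuous_const.mul
      ((continuous_apply j).comp (continuous_snd.comp continuous_subtype_val))
  · have := hR.seq_mem_Icc k.2 j
    rw [Real.norm_of_nonneg (mul_nonneg (by positivity) this.1)]
    exact mul_le_of_le_one_right (by positivity) this.2

theorem continuous_jumpCollapse (hR : IsFlowJump ϕ p R) : Continuous (jumpCollapse ϕ R t) :=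
  ϕ.continuous (hR.continuous_jumpShift.div_const 8) (continuous_fst.comp continuous_subtype_val)

theorem continuous_jumpMap : Continuous (jumpMap ϕ R t) := by
  refine Continuous.subtype_mk (Continuous.prodMk ?_ ?_) _
  · exact ϕ.continuous continuous_const (continuous_fst.comp continuous_subtype_val)
  · exact continuous_pi fun j =>
      (continuous_apply (j + 1)).comp (continuous_snd.comp continuous_subtype_val)

/-- Along a flow line the total displacement decreases with speed at most `4`. -/
theorem jumpShift_slope (hR : IsFlowJump ϕ p R) {z : X} {v w : ℕ → ℝ} {a : ℝ} (ha : 0 < a)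
    (hv : (z, v) ∈ jumpExtension ϕ R t) (hw : (ϕ a z, w) ∈ jumpExtension ϕ R t) :
    jumpShift v - 4 * a ≤ jumpShift w := by
  have h1 := summable_jump (hR.seq_mem_Icc hv)
  have h2 := summable_jump (hR.seq_mem_Icc hw)
  have h3 : Summable fun j : ℕ => (1 / 2 : ℝ) ^ j * (2 * a) := summable_geometric_two.mul_right _
  have h4 : ∑' j : ℕ, (1 / 2 : ℝ) ^ j * (2 * a) = 4 * a := by
    rw [tsum_mul_right, tsum_geometric_two]; ring
  have key : ∑' j, ((1 / 2 : ℝ) ^ j * v j - (1 / 2 : ℝ) ^ j * (2 * a)) ≤ jumpShift w := by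
    refine (h1.sub h3).tsum_le_tsum (fun j => ?_) h2
    rw [← mul_sub]
    refine mul_le_mul_of_nonneg_left (hR.slope ha (hv j) ?_) (by positivity)
    have := hw j
    simp only [← ϕ.map_add] at this ⊢
    rwa [add_comm]
  rw [h1.tsum_sub h3, h4] at key
  exact key

/-- Two points in the same fibre differ in at most one coordinate. -/
theorem eq_of_ne (hR : IsFlowJump ϕ p R) (ht : t ≠ 0) (hp : ∀ a, ϕ a p = p → a = 0) {z : X}
    {v w : ℕ → ℝ} (hv : (z, v) ∈ jumpExtension ϕ R t) (hw : (z, w) ∈ jumpExtension ϕ R t) {j : ℕ}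
    (hj : v j ≠ w j) {i : ℕ} (hij : i ≠ j) : v i = w i := by
  have hzj : ϕ (j * t) z = p := by
    by_contra hne
    exact hj (hR.unique hne (hv j) (hw j))
  refine hR.unique (fun hzi => hij ?_) (hv i) (hw i)
  have hzi : ϕ (i * t) z = p := hzi
  have : ϕ ((i - j : ℝ) * t) p = p := by
    rw [← hzj, ← ϕ.map_add, ← add_mul, sub_add_cancel, hzi, hzj]
  have h0 := (mul_eq_zero.1 (hp _ this)).resolve_right ht
  exact_mod_cast sub_eq_zero.1 h0

theorem injective_jumpCollapse (hR : IsFlowJump ϕ p R) (ht : t ≠ 0)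
    (hp : ∀ a, ϕ a p = p → a = 0) : Injective (jumpCollapse ϕ R t) := by
  have aux : ∀ (z : X) (v w : ℕ → ℝ) (a : ℝ), (z, v) ∈ jumpExtension ϕ R t →
      (ϕ a z, w) ∈ jumpExtension ϕ R t → jumpShift v / 8 = a + jumpShift w / 8 → a ≤ 0 := by
    intro z v w a hv hw h
    by_contra! ha
    have := hR.jumpShift_slope ha hv hw
    linarith
  rintro ⟨⟨z, v⟩, hv⟩ ⟨⟨z', w⟩, hw⟩ h
  simp only [jumpCollapse] at h
  have hz : z' = ϕ (jumpShift v / 8 - jumpShift w / 8) z := by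
    have := congrArg (ϕ (-(jumpShift w / 8))) h
    simp only [← ϕ.map_add, neg_add_cancel, ϕ.map_zero_apply] at this
    rw [← this]; congr 1; ring
  have ha : jumpShift v / 8 - jumpShift w / 8 ≤ 0 :=
    aux z v w _ hv (hz ▸ hw) (by ring)
  have hz' : z = ϕ (jumpShift w / 8 - jumpShift v / 8) z' := by
    rw [hz, ← ϕ.map_add]; simp
  have ha' : jumpShift w / 8 - jumpShift v / 8 ≤ 0 :=
    aux z' w v _ hw (hz' ▸ hv) (by ring)
  have hW : jumpShift v = jumpShift w := by linarith
  have hzz : z' = z := by rw [hz, hW, sub_self, ϕ.map_zero_apply]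
  subst hzz
  suffices v = w by simp [this]
  by_contra hne
  obtain ⟨j, hj⟩ := Function.ne_iff.1 hne
  have h1 := summable_jump (hR.seq_mem_Icc hv)
  have h2 := summable_jump (hR.seq_mem_Icc hw)
  have h3 : ∑' i, ((1 / 2 : ℝ) ^ i * v i - (1 / 2 : ℝ) ^ i * w i) = 0 := by
    rw [h1.tsum_sub h2]; exact sub_eq_zero.2 hW
  rw [tsum_eq_single j fun i hij => by rw [hR.eq_of_ne ht hp hv hw hj hij, sub_self],
    ← mul_sub] at h3
  exact (mul_ne_zero (by positivity) (sub_ne_zero.2 hj)) h3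

theorem exists_mem_jumpExtension (hR : IsFlowJump ϕ p R) (z : X) :
    ∃ v, (z, v) ∈ jumpExtension ϕ R t := by
  choose v hv using fun j : ℕ => hR.nonempty (ϕ (j * t) z)
  exact ⟨v, hv⟩

/-- The fibres of the extension are convex, so all intermediate displacements occur. -/
theorem exists_jumpShift_eq (hR : IsFlowJump ϕ p R) {z : X} {v w : ℕ → ℝ}
    (hv : (z, v) ∈ jumpExtension ϕ R t) (hw : (z, w) ∈ jumpExtension ϕ R t) {b : ℝ}
    (hb : b ∈ Icc (jumpShift v) (jumpShift w)) :
    ∃ u, (z, u) ∈ jumpExtension ϕ R t ∧ jumpShift u = b := by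
  rw [← segment_eq_Icc (hb.1.trans hb.2)] at hb
  obtain ⟨r, s, hr, hs, hrs, rfl⟩ := hb
  refine ⟨fun j => r * v j + s * w j, fun j => ?_, ?_⟩
  · have hv' := hR.mem_Icc (hv j)
    have hw' := hR.mem_Icc (hw j)
    by_cases hz : ϕ (j * t) z = p
    · simp only [hz]
      exact hR.full (convex_Icc (0 : ℝ) 1 hv' hw' hr hs hrs)
    · have h := hR.unique hz (hv j) (hw j)
      simp only at h
      simp only [h, ← add_mul, hrs, one_mul]
      exact hw j
  · have h1 := summable_jump (hR.seq_mem_Icc hv)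
    have h2 := summable_jump (hR.seq_mem_Icc hw)
    simp only [jumpShift, smul_eq_mul]
    rw [← tsum_mul_left, ← tsum_mul_left, ← (h1.mul_left r).tsum_add (h2.mul_left s)]
    exact tsum_congr fun j => by ring

theorem surjective_jumpCollapse [CompactSpace X] [T2Space X] (hR : IsFlowJump ϕ p R) :
    Surjective (jumpCollapse ϕ R t) := by
  intro y
  have := hR.compactSpace_jumpExtension (t := t)
  have hW : Continuous fun q : ℝ × jumpExtension ϕ R t => jumpShift q.2.1.2 / 8 :=
    (hR.continuous_jumpShift.comp continuous_snd).div_const 8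
  have hcl : IsClosed {q : ℝ × jumpExtension ϕ R t | q.2.1.1 = ϕ (-q.1) y} :=
    isClosed_eq (continuous_fst.comp (continuous_subtype_val.comp continuous_snd))
      (ϕ.continuous continuous_fst.neg continuous_const)
  have hA := isClosedMap_fst_of_compactSpace _ (hcl.inter (isClosed_le continuous_fst hW))
  have hB := isClosedMap_fst_of_compactSpace _ (hcl.inter (isClosed_le hW continuous_fst))
  obtain ⟨v₀, hv₀⟩ := hR.exists_mem_jumpExtension (t := t) (ϕ (-0) y)
  obtain ⟨v₁, hv₁⟩ := hR.exists_mem_jumpExtension (t := t) (ϕ (-1) y)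
  have h₀ := jumpShift_mem_Icc (hR.seq_mem_Icc hv₀)
  have h₁ := jumpShift_mem_Icc (hR.seq_mem_Icc hv₁)
  obtain ⟨a, -, ⟨⟨-, ⟨⟨z, w⟩, hw⟩⟩, ⟨hz, hw'⟩, rfl⟩, ⟨⟨a, ⟨⟨z', v⟩, hv⟩⟩, ⟨hz', hv'⟩, rfl⟩⟩ :=
    isPreconnected_closed_iff.1 (isPreconnected_Icc (a := (0 : ℝ)) (b := 1)) _ _ hA hB
      (fun a _ => by
        obtain ⟨v, hv⟩ := hR.exists_mem_jumpExtension (t := t) (ϕ (-a) y)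
        rcases le_total a (jumpShift v / 8) with h | h
        · exact Or.inl ⟨(a, ⟨_, hv⟩), ⟨rfl, h⟩, rfl⟩
        · exact Or.inr ⟨(a, ⟨_, hv⟩), ⟨rfl, h⟩, rfl⟩)
      ⟨0, by simp, (0, ⟨_, hv₀⟩), ⟨rfl, div_nonneg h₀.1 (by norm_num)⟩, rfl⟩
      ⟨1, by simp, (1, ⟨_, hv₁⟩), ⟨rfl, show jumpShift v₁ / 8 ≤ 1 by linarith [h₁.2]⟩, rfl⟩
  simp only [mem_ofPred_eq] at hz hz' hw' hv'
  subst hz hz'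
  obtain ⟨u, hu, hu'⟩ := hR.exists_jumpShift_eq hv hw (b := 8 * a)
    ⟨by linarith, by linarith⟩
  refine ⟨⟨_, hu⟩, ?_⟩
  simp only [jumpCollapse, hu', ← ϕ.map_add]
  rw [show 8 * a / 8 + -a = 0 by ring, ϕ.map_zero_apply]

/-- The extension is homeomorphic to the original space. -/
noncomputable def collapseHomeomorph [CompactSpace X] [T2Space X] (hR : IsFlowJump ϕ p R)
    (ht : t ≠ 0) (hp : ∀ a, ϕ a p = p → a = 0) : jumpExtension ϕ R t ≃ₜ X :=
  haveI := hR.compactSpace_jumpExtension (t := t)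
  Continuous.homeoOfEquivCompactToT2
    (f := Equiv.ofBijective (jumpCollapse ϕ R t)
      ⟨hR.injective_jumpCollapse ht hp, hR.surjective_jumpCollapse⟩)
    hR.continuous_jumpCollapse

theorem not_injective_jumpMap (hR : IsFlowJump ϕ p R) : ¬ Injective (jumpMap ϕ R t) := by
  intro hinj
  obtain ⟨v, hv⟩ := hR.exists_mem_jumpExtension (t := t) p
  have key : ∀ b ∈ Icc (0 : ℝ) 1, (p, update v 0 b) ∈ jumpExtension ϕ R t := by
    rintro b hb (_ | j)
    · simpa [ϕ.map_zero_apply] using hR.full hb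
    · simpa using hv (j + 1)
  have h := @hinj ⟨_, key 0 (by simp)⟩ ⟨_, key 1 (by simp)⟩ (by simp [jumpMap])
  have h' := congrFun (congrArg (fun k => k.1.2) h) 0
  simp at h'

theorem isMinimalMap_jumpMap [CompactSpace X] [T2Space X] (hR : IsFlowJump ϕ p R) (ht : t ≠ 0)
    (hp : ∀ a, ϕ a p = p → a = 0) (hmin : IsMinimalMap (ϕ t))
    (hdense : Dense (range fun a => ϕ a p)ᶜ) : IsMinimalMap (jumpMap ϕ R t) := by
  refine ⟨continuous_jumpMap, fun k => ?_⟩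
  have := hR.compactSpace_jumpExtension (t := t)
  set M := closure (range fun n : ℕ => (jumpMap ϕ R t)^[n + 1] k)
  let π : jumpExtension ϕ R t → X := fun k => k.1.1
  have hπ : Continuous π := continuous_fst.comp continuous_subtype_val
  have hsemi : Semiconj π (jumpMap ϕ R t) (ϕ t) := fun _ => rfl
  have hπM : π '' M = univ := by
    have hc : IsClosed (π '' M) := (isClosed_closure.isCompact.image hπ).isClosed
    refine (hmin.2 (π k)).closure_eq ▸ (hc.closure_subset_iff.2 ?_).antisymm' (fun _ _ => ?_)
    · rintro _ ⟨n, rfl⟩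
      exact ⟨_, subset_closure ⟨n, rfl⟩, hsemi.iterate_right (n + 1) k⟩
    · rw [(hmin.2 (π k)).closure_eq]; trivial
  let Φ := hR.collapseHomeomorph ht hp
  have hsub : Φ ⁻¹' (range fun a => ϕ a p)ᶜ ⊆ M := by
    rintro ⟨⟨z, v⟩, hv⟩ hz
    obtain ⟨⟨⟨z', w⟩, hw⟩, hmem, rfl⟩ : z ∈ π '' M := hπM ▸ mem_univ z
    suffices v = w by subst this; exact hmem
    funext j
    refine hR.unique (fun hj => hz ?_) (hv j) (hw j)
    have hj : ϕ (j * t) z' = p := hj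
    refine ⟨jumpShift v / 8 + -(j * t), ?_⟩
    show ϕ _ p = ϕ (jumpShift v / 8) z'
    rw [← hj, ← ϕ.map_add]
    congr 1; ring
  have hd : Dense (Φ ⁻¹' (range fun a => ϕ a p)ᶜ) := hdense.preimage Φ.isOpenMap
  exact dense_closure.1 (hd.mono hsub)

/-- A minimal time-`t` map of a flow with a jump function can be blown up to a noninvertible
minimal map of the same space. -/
theorem exists_noninvertible_minimal [CompactSpace X] [T2Space X] (hR : IsFlowJump ϕ p R)
    (ht : t ≠ 0) (hp : ∀ a, ϕ a p = p → a = 0) (hmin : IsMinimalMap (ϕ t))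
    (hdense : Dense (range fun a => ϕ a p)ᶜ) :
    ∃ f : X → X, IsMinimalMap f ∧ ¬ Injective f := by
  let Φ := hR.collapseHomeomorph ht hp
  have hF := hR.isMinimalMap_jumpMap ht hp hmin hdense
  have hsemi : Semiconj Φ (jumpMap ϕ R t) (Φ ∘ jumpMap ϕ R t ∘ Φ.symm) := fun k => by simp
  refine ⟨Φ ∘ jumpMap ϕ R t ∘ Φ.symm,
    ⟨Φ.continuous.comp (hF.1.comp Φ.symm.continuous), fun y => ?_⟩, fun hinj => ?_⟩
  · obtain ⟨k, rfl⟩ := Φ.surjective y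
    have := Φ.surjective.denseRange.dense_image Φ.continuous (hF.2 k)
    rw [← range_comp] at this
    convert this using 3 with n
    exact (hsemi.iterate_right (n + 1) k).symm
  · refine hR.not_injective_jumpMap (t := t) fun k l hkl => ?_
    exact Φ.injective (hinj (by simp [hkl]))

end IsFlowJump

end JumpExtension

section MinimalMaps

variable {X : Type*} [TopologicalSpace X]

theorem IsMinimalMap.surjective [CompactSpace X] [T2Space X] {f : X → X} (hf : IsMinimalMap f) :
    Surjective f := by
  intro y
  have hc : IsClosed (range f) := (isCompact_range hf.1).isClosed
  have : Dense (range f) := (hf.2 y).mono <| by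
    rintro _ ⟨n, rfl⟩
    exact ⟨f^[n] y, (iterate_succ_apply' f n y).symm⟩
  have hy := this y
  rwa [hc.closure_eq] at hy

/-- If one time-`t` orbit of a flow is dense and every forward flow line is dense then the
time-`t` map is minimal. -/
theorem Flow.isMinimalMap_of_dense_orbit [CompactSpace X] [T2Space X] (ϕ : Flow ℝ X) {t : ℝ}
    (ht : 0 < t) (hϕ : ∀ x, Dense ((fun a => ϕ a x) '' Ici 0)) {x₀ : X}
    (hx₀ : Dense (range fun n : ℕ => ϕ ((n + 1 : ℕ) * t) x₀)) : IsMinimalMap (ϕ t) := by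
  have hc : Continuous (ϕ t) := ϕ.continuous continuous_const continuous_id
  have hiter : ∀ (n : ℕ) x, (ϕ t)^[n] x = ϕ (n * t) x := by
    intro n x
    induction n with
    | zero => simp [ϕ.map_zero_apply]
    | succ n ih => rw [iterate_succ_apply', ih, ← ϕ.map_add]; congr 1; push_cast; ring
  refine ⟨hc, fun x => ?_⟩
  simp only [hiter]
  set Y := closure (range fun n : ℕ => ϕ ((n + 1 : ℕ) * t) x)
  have hYcl : IsClosed Y := isClosed_closure
  have hYinv : ∀ n : ℕ, ∀ y ∈ Y, ϕ (n * t) y ∈ Y := by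
    intro n y hy
    refine map_mem_closure (ϕ.continuous continuous_const continuous_id) hy ?_
    rintro _ ⟨m, rfl⟩
    refine ⟨n + m, ?_⟩
    simp only [← ϕ.map_add]
    congr 1; push_cast; ring
  -- the union of the translates of `Y` over one period is everything
  have hZcl : IsClosed ((fun q : ℝ × X => ϕ q.1 q.2) '' (Icc 0 t ×ˢ Y)) :=
    ((isCompact_Icc.prod hYcl.isCompact).image (ϕ.continuous continuous_fst continuous_snd)).isClosed
  have hxY : ϕ t x ∈ Y := subset_closure ⟨0, by simp⟩
  have hZ : Dense ((fun q : ℝ × X => ϕ q.1 q.2) '' (Icc 0 t ×ˢ Y)) := by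
    refine (hϕ (ϕ t x)).mono ?_
    rintro _ ⟨a, ha, rfl⟩
    have ha : 0 ≤ a := ha
    have h1 := Nat.floor_le (div_nonneg ha ht.le)
    have h2 := Nat.lt_floor_add_one (a / t)
    rw [le_div_iff₀ ht] at h1
    rw [div_lt_iff₀ ht] at h2
    refine ⟨(a - ⌊a / t⌋₊ * t, ϕ (⌊a / t⌋₊ * t) (ϕ t x)),
      ⟨⟨by linarith, by linarith⟩, hYinv _ _ hxY⟩, ?_⟩
    simp only [← ϕ.map_add]
    congr 1; ring
  obtain ⟨⟨s, y⟩, ⟨-, hy⟩, hsy⟩ := hZcl.closure_eq ▸ hZ x₀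
  have hy' : y = ϕ (-s) x₀ := by
    rw [← hsy, ← ϕ.map_add]; simp [ϕ.map_zero_apply]
  let σ : X ≃ₜ X := ϕ.toHomeomorph (-s)
  have hσ := σ.surjective.denseRange.dense_image σ.continuous hx₀
  rw [← dense_closure]
  refine hσ.mono ?_
  rintro _ ⟨_, ⟨n, rfl⟩, rfl⟩
  have := hYinv (n + 1) y hy
  rw [hy', ← ϕ.map_add] at this
  show ϕ (-s) (ϕ _ x₀) ∈ Y
  rwa [← ϕ.map_add, add_comm]

/-- A flow on a compact second countable space whose forward flow lines are all dense has a
minimal time-`t` map. -/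
theorem Flow.exists_isMinimalMap [CompactSpace X] [T2Space X] [SecondCountableTopology X]
    [Nonempty X] (ϕ : Flow ℝ X) (hϕ : ∀ x, Dense ((fun a => ϕ a x) '' Ici 0)) :
    ∃ t > 0, IsMinimalMap (ϕ t) := by
  obtain ⟨x₀⟩ := ‹Nonempty X›
  let B := TopologicalSpace.countableBasis X
  have hBc : B.Countable := TopologicalSpace.countable_countableBasis X
  have : Countable B := hBc.to_subtype
  let O : B → Set ℝ := fun U => Iio 0 ∪ ⋃ n : ℕ, {t | ϕ ((n + 1 : ℕ) * t) x₀ ∈ U.1}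
  have hO : ∀ U, IsOpen (O U) := fun U => isOpen_Iio.union <| isOpen_iUnion fun n =>
    (TopologicalSpace.isOpen_of_mem_countableBasis U.2).preimage
      (ϕ.continuous (continuous_const.mul continuous_id) continuous_const)
  have hOd : ∀ U, Dense (O U) := by
    intro U
    rw [dense_iff_inter_open]
    rintro V hV ⟨r, hr⟩
    by_contra hemp
    have hV0 : ∀ s ∈ V, s ∉ O U := fun s hs hsO => hemp ⟨s, hs, hsO⟩
    have hr0 : 0 ≤ r := not_lt.1 fun h => hV0 r hr (Or.inl h)
    obtain ⟨ε, hε, hball⟩ := Metric.isOpen_iff.1 hV r hr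
    -- the interval `(b, c)` lies in `V` and has positive end points
    obtain ⟨b, c, hb, hbc, hIoo⟩ : ∃ b c, 0 < b ∧ b < c ∧ Ioc b c ⊆ V := by
      refine ⟨r + ε / 3, r + ε / 2, by linarith, by linarith, fun s hs => hball ?_⟩
      rw [Real.ball_eq_Ioo]
      exact ⟨by linarith [hs.1], by linarith [hs.2]⟩
    have hcpos : 0 < c := hb.trans hbc
    let S : ℝ := 1 / (1 / b - 1 / c) + 1
    have hdiff : 0 < 1 / b - 1 / c := sub_pos.2 (one_div_lt_one_div_of_lt hb hbc)
    obtain ⟨_, ⟨a, ha, rfl⟩, haU⟩ := (hϕ (ϕ S x₀)).exists_mem_open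
      (TopologicalSpace.isOpen_of_mem_countableBasis U.2)
      (TopologicalSpace.nonempty_of_mem_countableBasis U.2)
    have ha : 0 ≤ a := ha
    simp only [← ϕ.map_add] at haU
    set s := a + S with hs
    have hsS : 1 / (1 / b - 1 / c) < s := by simp only [hs, S]; linarith
    rw [div_lt_iff₀ hdiff] at hsS
    have hs0 : 0 < s := by
      by_contra! hneg
      nlinarith
    have hfl := Nat.lt_floor_add_one (s / c)
    have hfl' := Nat.floor_le (div_nonneg hs0.le hcpos.le)
    set n := ⌊s / c⌋₊
    have hn : (0 : ℝ) < ((n + 1 : ℕ) : ℝ) := by positivity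
    refine hV0 (s / (n + 1 : ℕ)) (hIoo ⟨?_, ?_⟩) (Or.inr (mem_iUnion.2 ⟨n, ?_⟩))
    · rw [lt_div_iff₀ hn]
      have h1 : ((n + 1 : ℕ) : ℝ) < s / b := by
        push_cast
        have : s * (1 / b - 1 / c) = s / b - s / c := by ring
        linarith
      rw [lt_div_iff₀ hb] at h1
      linarith
    · rw [div_le_iff₀ hn]
      rw [div_lt_iff₀ hcpos] at hfl
      push_cast
      linarith
    · show ϕ _ x₀ ∈ U.1
      rwa [mul_div_cancel₀ _ hn.ne']
  obtain ⟨t, htO, ht0⟩ := (dense_iInter_of_isOpen hO hOd).exists_mem_open isOpen_Ioi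
    (nonempty_Ioi (a := (0 : ℝ)))
  refine ⟨t, ht0, ϕ.isMinimalMap_of_dense_orbit ht0 hϕ (x₀ := x₀) ?_⟩
  rw [(TopologicalSpace.isBasis_countableBasis X).dense_iff]
  intro U hU _
  obtain h | h := mem_iInter.1 htO ⟨U, hU⟩
  · exact absurd (show 0 < t from ht0) (not_lt.2 (le_of_lt h))
  · obtain ⟨n, hn⟩ := mem_iUnion.1 h
    exact ⟨_, hn, n, rfl⟩

end MinimalMaps

section MinimalHomeo

variable {C : Type*} [TopologicalSpace C] {h : C ≃ₜ C}

theorem IsMinimalMap.zpow_eq_zero [T1Space C] [Infinite C] (hmin : IsMinimalMap (h : C → C))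
    {n : ℤ} {x : C} (hn : (h.toEquiv ^ n) x = x) : n = 0 := by
  by_contra hne
  have hpos : 0 < n.natAbs := Int.natAbs_pos.2 hne
  have hper : IsPeriodicPt h n.natAbs x := by
    have : (h.toEquiv ^ (n.natAbs : ℤ)) x = x := by
      rcases Int.natAbs_eq n with h' | h'
      · rwa [← h']
      · rw [h', zpow_neg, Equiv.Perm.inv_eq_iff_eq] at hn
        exact hn.symm
    rw [zpow_natCast] at this
    rwa [IsPeriodicPt, IsFixedPt, ← h.coe_toEquiv, ← Equiv.Perm.coe_pow]
  have hfin : (range fun k : ℕ => h^[k + 1] x).Finite := by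
    refine ((finite_lt_nat n.natAbs).image fun k => h^[k] x).subset ?_
    rintro _ ⟨k, rfl⟩
    exact ⟨(k + 1) % n.natAbs, Nat.mod_lt _ hpos, hper.iterate_mod_apply _⟩
  have huniv := hfin.isClosed.closure_eq.symm.trans (hmin.2 x).closure_eq
  exact infinite_univ (huniv ▸ hfin)

theorem IsMinimalMap.not_isOpen_singleton [T1Space C] [Infinite C]
    (hmin : IsMinimalMap (h : C → C)) (x : C) : ¬ IsOpen ({x} : Set C) := by
  intro hx
  obtain ⟨_, ⟨n, rfl⟩, hn⟩ := (hmin.2 x).exists_mem_open hx (singleton_nonempty x)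
  have : (h.toEquiv ^ ((n + 1 : ℕ) : ℤ)) x = x := by
    rw [zpow_natCast, Equiv.Perm.coe_pow]
    exact hn
  have := hmin.zpow_eq_zero this
  omega

theorem Homeomorph.continuous_toEquiv_zpow (n : ℤ) : Continuous ⇑(h.toEquiv ^ n) := by
  cases n with
  | ofNat n =>
    rw [Int.ofNat_eq_natCast, zpow_natCast, Equiv.Perm.coe_pow]
    exact h.continuous.iterate n
  | negSucc n =>
    rw [zpow_negSucc, ← inv_pow, Equiv.Perm.coe_pow]
    exact h.symm.continuous.iterate (n + 1)

end MinimalHomeo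

namespace Susp

section

variable {C : Type*} [TopologicalSpace C] (h : C ≃ₜ C)

/-- The point of the suspension reached from `(x, 0)` after flowing for time `r`, the direction
of the flow being chosen so that its time-one map extends `h`. -/
def mk (q : C × ℝ) : Susp h := Quot.mk _ (q.1, -q.2)

variable {h}

theorem equivalence_suspRel : Equivalence (suspRel h) where
  refl a := ⟨0, by simp, by simp⟩
  symm := by
    rintro a b ⟨n, h1, h2⟩
    exact ⟨-n, by push_cast; linarith, by rw [h2, ← Equiv.Perm.mul_apply, ← zpow_add]; simp⟩
  trans := by
    rintro a b c ⟨n, h1, h2⟩ ⟨m, h3, h4⟩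
    refine ⟨n + m, by push_cast; linarith, ?_⟩
    rw [h4, h2, ← Equiv.Perm.mul_apply, ← zpow_add]
    congr 2; ring

theorem mk_eq_mk {q q' : C × ℝ} :
    mk h q = mk h q' ↔ ∃ n : ℤ, q.2 - q'.2 = n ∧ q'.1 = (h.toEquiv ^ n) q.1 := by
  rw [mk, mk, equivalence_suspRel.quot_mk_eq_iff]
  constructor
  · rintro ⟨n, h1, h2⟩
    exact ⟨-n, by push_cast; simp only at h1; linarith, h2⟩
  · rintro ⟨n, h1, h2⟩
    exact ⟨-n, by push_cast; linarith, by simpa using h2⟩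

theorem mk_add_int (x : C) (r : ℝ) (n : ℤ) : mk h (x, r + n) = mk h ((h.toEquiv ^ n) x, r) :=
  mk_eq_mk.2 ⟨n, by simp, rfl⟩

theorem mk_fract (x : C) (r : ℝ) :
    mk h (x, r) = mk h ((h.toEquiv ^ ⌊r⌋) x, Int.fract r) := by
  rw [← mk_add_int, Int.fract_add_floor]

theorem surjective_mk : Surjective (mk h) := by
  rintro ⟨x, r⟩
  exact ⟨(x, -r), by simp [mk]⟩

theorem continuous_mk : Continuous (mk h) :=
  continuous_quot_mk.comp (continuous_fst.prodMk continuous_snd.neg)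

theorem isOpenMap_mk : IsOpenMap (mk h) := by
  intro O hO
  have hq : IsQuotientMap (Quot.mk (suspRel h)) := isQuotientMap_quot_mk
  have : Quot.mk (suspRel h) ⁻¹' (mk h '' O) =
      ⋃ n : ℤ, (fun q : C × ℝ => ((h.toEquiv ^ n) q.1, -q.2 - n)) ⁻¹' O := by
    ext ⟨x, r⟩
    have hx : Quot.mk (suspRel h) (x, r) = mk h (x, -r) := by simp [mk]
    simp only [mem_preimage, hx, mem_image, mem_iUnion]
    constructor
    · rintro ⟨⟨y, s⟩, hy, hys⟩
      obtain ⟨n, h1, h2⟩ := mk_eq_mk.1 hys.symm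
      refine ⟨n, ?_⟩
      simp only at h1 h2
      rwa [← h2, ← h1, sub_sub_cancel]
    · rintro ⟨n, hn⟩
      exact ⟨_, hn, (mk_eq_mk.2 ⟨n, by simp, rfl⟩).symm⟩
  rw [← hq.isOpen_preimage, this]
  exact isOpen_iUnion fun n => hO.preimage
    (((h.continuous_toEquiv_zpow n).comp continuous_fst).prodMk
      (continuous_snd.neg.sub continuous_const))

theorem isOpenQuotientMap_mk : IsOpenQuotientMap (mk h) :=
  ⟨surjective_mk, continuous_mk, isOpenMap_mk⟩

theorem exists_mk_eq (z : Susp h) : ∃ x, ∃ r ∈ Ico (0 : ℝ) 1, mk h (x, r) = z := by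
  obtain ⟨⟨x, r⟩, rfl⟩ := surjective_mk z
  exact ⟨_, _, ⟨Int.fract_nonneg r, Int.fract_lt_one r⟩, (mk_fract x r).symm⟩

theorem mk_eq_mk_of_mem_Ioo {x y : C} {r s : ℝ} (hr : r ∈ Ioo (0 : ℝ) 1) (hs : s ∈ Icc (0 : ℝ) 1)
    (hrs : mk h (x, r) = mk h (y, s)) : x = y ∧ r = s := by
  obtain ⟨n, h1, h2⟩ := mk_eq_mk.1 hrs
  simp only at h1 h2
  have h3 : (n : ℝ) < 1 := by linarith [hr.2, hs.1]
  have h4 : (-1 : ℝ) < n := by linarith [hr.1, hs.2]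
  have hn : n = 0 := by
    have h3 : n < 1 := by exact_mod_cast h3
    have h4 : -1 < n := by exact_mod_cast h4
    omega
  subst hn
  simp only [Int.cast_zero, zpow_zero, Equiv.Perm.coe_one, id_eq] at h1 h2
  exact ⟨h2.symm, sub_eq_zero.1 h1⟩

instance compactSpace [CompactSpace C] : CompactSpace (Susp h) := by
  refine ⟨?_⟩
  convert (isCompact_univ.prod (isCompact_Icc (a := (0 : ℝ)) (b := 1))).image
    (continuous_mk (h := h))
  refine (eq_univ_of_forall fun z => ?_).symm
  obtain ⟨x, r, hr, rfl⟩ := exists_mk_eq z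
  exact ⟨_, ⟨mem_univ x, Ico_subset_Icc_self hr⟩, rfl⟩

instance t2Space [T2Space C] : T2Space (Susp h) := by
  rw [t2Space_iff_of_isOpenQuotientMap isOpenQuotientMap_mk]
  have hlf : LocallyFinite fun n : ℤ => ({(n : ℝ)} : Set ℝ) := by
    intro r
    refine ⟨Ioo (r - 1) (r + 1), Ioo_mem_nhds (by linarith) (by linarith),
      (finite_Icc ⌊r - 1⌋ ⌈r + 1⌉).subset ?_⟩
    rintro n ⟨_, rfl, hn⟩
    exact ⟨Int.floor_le_iff.2 (by linarith [hn.1]), Int.le_ceil_iff.2 (by linarith [hn.2])⟩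
  have : {q : (C × ℝ) × C × ℝ | mk h q.1 = mk h q.2} =
      ⋃ n : ℤ, {q : (C × ℝ) × C × ℝ | q.1.2 - q.2.2 = (n : ℝ) ∧ q.2.1 = (h.toEquiv ^ n) q.1.1} := by
    ext q
    simp [mk_eq_mk]
  rw [this]
  refine LocallyFinite.isClosed_iUnion ?_ fun n => ?_
  · refine (hlf.preimage_continuous
      (g := fun q : (C × ℝ) × C × ℝ => q.1.2 - q.2.2) (by fun_prop)).subset fun n q hq => hq.1
  · exact (isClosed_eq (by fun_prop) continuous_const).inter <| isClosed_eq (by fun_prop)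
      ((h.continuous_toEquiv_zpow n).comp (by fun_prop))

instance secondCountableTopology [SecondCountableTopology C] :
    SecondCountableTopology (Susp h) :=
  isOpenQuotientMap_mk.isQuotientMap.secondCountableTopology isOpenMap_mk

theorem suspRel_sub_right (a : ℝ) {p q : C × ℝ} (hpq : suspRel h p q) :
    suspRel h (p.1, p.2 - a) (q.1, q.2 - a) := by
  obtain ⟨n, h1, h2⟩ := hpq
  exact ⟨n, by simpa using h1, h2⟩

variable (h) in
/-- The suspension flow, directed so that its time-one map extends `h`. -/
def flow : Flow ℝ (Susp h) where
  toFun a := Quot.map (fun q => (q.1, q.2 - a)) fun _ _ => suspRel_sub_right a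
  cont' := by
    refine (IsOpenQuotientMap.id.prodMap (isOpenQuotientMap_mk (h := h))).continuous_comp_iff.1 ?_
    refine ((continuous_mk (h := h)).comp (f := fun q : ℝ × C × ℝ => (q.2.1, q.2.2 + q.1))
      (by fun_prop)).congr fun q => ?_
    show Quot.mk _ (q.2.1, -(q.2.2 + q.1)) = Quot.mk _ (q.2.1, -q.2.2 - q.1)
    rw [neg_add']
  map_add' := by
    rintro a b ⟨x, r⟩
    simp only [Quot.map]
    congr 2
    ring
  map_zero' := by
    rintro ⟨x, r⟩
    simp [Quot.map]

@[simp]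
theorem flow_mk (a : ℝ) (x : C) (r : ℝ) : flow h a (mk h (x, r)) = mk h (x, r + a) := by
  show Quot.mk _ (x, -r - a) = Quot.mk _ (x, -(r + a))
  congr 2
  ring

theorem flow_eq_self [T1Space C] [Infinite C] (hmin : IsMinimalMap (h : C → C)) {a : ℝ}
    {z : Susp h} (hz : flow h a z = z) : a = 0 := by
  obtain ⟨⟨x, r⟩, rfl⟩ := surjective_mk z
  rw [flow_mk] at hz
  obtain ⟨n, h1, h2⟩ := mk_eq_mk.1 hz
  have hn := hmin.zpow_eq_zero h2.symm
  subst hn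
  simpa using h1

theorem dense_flow (hmin : IsMinimalMap (h : C → C)) (z : Susp h) :
    Dense ((fun a => flow h a z) '' Ici 0) := by
  obtain ⟨⟨x, r⟩, rfl⟩ := surjective_mk z
  rw [dense_iff_inter_open]
  rintro U hU ⟨w, hw⟩
  obtain ⟨⟨y, s⟩, rfl⟩ := surjective_mk w
  obtain ⟨m, hm⟩ := exists_nat_ge (r - s)
  -- an open set of points of the section whose orbits visit `U` at time `s - r + m`
  have hV : IsOpen {x' : C | mk h (x', s) ∈ U} :=
    hU.preimage (continuous_mk.comp (continuous_id.prodMk continuous_const))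
  obtain ⟨_, ⟨n, rfl⟩, hn⟩ := (hmin.2 (h^[m] x)).exists_mem_open hV ⟨y, hw⟩
  refine ⟨_, hn, s - r + ((n + 1 + m : ℕ) : ℤ), ?_, ?_⟩
  · have : (0 : ℝ) ≤ n := n.cast_nonneg
    simp only [mem_Ici]
    push_cast
    linarith
  · simp only [flow_mk]
    rw [← add_assoc, add_sub_cancel, mk_add_int, zpow_natCast, Equiv.Perm.coe_pow,
      iterate_add_apply]
    rfl

theorem connectedSpace [Nonempty C] (hmin : IsMinimalMap (h : C → C)) :
    ConnectedSpace (Susp h) := by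
  obtain ⟨x⟩ := ‹Nonempty C›
  have hd : DenseRange fun a => flow h a (mk h (x, 0)) :=
    (dense_flow hmin (mk h (x, 0))).mono (image_subset_range _ _)
  have := hd.preconnectedSpace ((flow h).continuous continuous_id continuous_const)
  exact { toNonempty := ⟨mk h (x, 0)⟩ }

theorem nontrivial [Nonempty C] : Nontrivial (Susp h) := by
  obtain ⟨x⟩ := ‹Nonempty C›
  refine ⟨mk h (x, 1 / 2), mk h (x, 0), fun hx => ?_⟩
  have := (mk_eq_mk_of_mem_Ioo (by norm_num) (by simp) hx).2
  norm_num at this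

/-- The complement of a flow line is dense. -/
theorem dense_compl_flow_line [CompactSpace C] [T2Space C] [Infinite C]
    (hmin : IsMinimalMap (h : C → C)) (z : Susp h) : Dense (range fun a => flow h a z)ᶜ := by
  obtain ⟨⟨c, s⟩, rfl⟩ := surjective_mk z
  have hd : Dense (⋂ n : ℤ, ({(h.toEquiv ^ n) c} : Set C)ᶜ) :=
    dense_iInter_of_isOpen (fun n => isOpen_compl_singleton) fun n =>
      dense_compl_singleton_iff_not_open.2 (hmin.not_isOpen_singleton _)
  obtain ⟨y, hy⟩ := hd.nonempty
  refine (dense_flow hmin (mk h (y, 0))).mono ?_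
  rintro _ ⟨a, -, rfl⟩ ⟨b, hb⟩
  simp only [flow_mk] at hb
  obtain ⟨n, -, h2⟩ := mk_eq_mk.1 hb
  exact mem_iInter.1 hy n h2

end

section Jump

variable {C : Type*} [MetricSpace C] {h : C ≃ₜ C}

/-- The fixed point equation describing the values over `(x, r)`, `r ∈ [0, 1]`, of a function that
jumps at `(c, 1 / 2)`. For `x ≠ c` its only solution is the
projection of `(r - 1 / 2) / dist x c` to `[0, 2 - 2 * r]`. -/
def JumpEq (c x : C) (r v : ℝ) : Prop :=
  v = max 0 (min (v + r - 1 / 2 - dist x c * v) (2 - 2 * r))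

/-- The jump function at `(c, 1 / 2)`, as a subset of `Susp h × ℝ`. -/
def jump (h : C ≃ₜ C) (c : C) : Set (Susp h × ℝ) :=
  (fun q : (C × ℝ) × ℝ => (mk h q.1, q.2)) ''
    {q | q ∈ (univ ×ˢ Icc 0 1) ×ˢ Icc 0 1 ∧ JumpEq c q.1.1 q.1.2 q.2}

theorem mem_jump {c : C} {z : Susp h} {v : ℝ} : (z, v) ∈ jump h c ↔
    ∃ x, ∃ r ∈ Icc (0 : ℝ) 1, mk h (x, r) = z ∧ v ∈ Icc (0 : ℝ) 1 ∧ JumpEq c x r v := by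
  constructor
  · rintro ⟨⟨⟨x, r⟩, w⟩, ⟨⟨⟨-, hr⟩, hv⟩, hj⟩, heq⟩
    obtain ⟨rfl, rfl⟩ := Prod.mk.inj heq
    exact ⟨x, r, hr, rfl, hv, hj⟩
  · rintro ⟨x, r, hr, rfl, hv, hj⟩
    exact ⟨((x, r), v), ⟨⟨⟨mem_univ _, hr⟩, hv⟩, hj⟩, rfl⟩

namespace JumpEq

variable {c x : C} {r v w : ℝ}

theorem nonneg (hv : JumpEq c x r v) : 0 ≤ v := by
  rw [hv]; exact le_max_left _ _

theorem bounds_of_pos (hv : JumpEq c x r v) (h0 : 0 < v) :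
    dist x c * v ≤ r - 1 / 2 ∧ v ≤ 2 - 2 * r := by
  have h1 : v ≤ min (v + r - 1 / 2 - dist x c * v) (2 - 2 * r) := by
    rcases max_choice 0 (min (v + r - 1 / 2 - dist x c * v) (2 - 2 * r)) with h | h
    · rw [JumpEq, h] at hv; exact absurd hv h0.ne'
    · exact (hv.trans h).le
  exact ⟨by linarith [h1.trans (min_le_left _ _)], h1.trans (min_le_right _ _)⟩

theorem mem_Ioo_of_pos (hv : JumpEq c x r v) (h0 : 0 < v) : r ∈ Ioo (0 : ℝ) 1 := by
  have := hv.bounds_of_pos h0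
  have := mul_nonneg (dist_nonneg (x := x) (y := c)) h0.le
  constructor <;> linarith

theorem min_le (hv : JumpEq c x r v) : min (v + r - 1 / 2 - dist x c * v) (2 - 2 * r) ≤ v :=
  (le_max_right _ _).trans hv.ge

theorem eq_of_lt (hv : JumpEq c x r v) (hw : JumpEq c x r w) (hvw : v < w) :
    x = c ∧ r = 1 / 2 := by
  obtain ⟨h1, h2⟩ := hw.bounds_of_pos (hv.nonneg.trans_lt hvw)
  have h3 : r - 1 / 2 ≤ dist x c * v := by
    rcases min_le_iff.1 hv.min_le with h | h <;> linarith
  have hd := dist_nonneg (x := x) (y := c)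
  have hd0 : dist x c = 0 := by
    by_contra hne
    have := mul_lt_mul_of_pos_left hvw (lt_of_le_of_ne hd (Ne.symm hne))
    linarith
  rw [hd0] at h1 h3
  exact ⟨dist_eq_zero.1 hd0, by linarith⟩

theorem exists_solution (c x : C) {r : ℝ} (hr : r ∈ Icc (0 : ℝ) 1) :
    ∃ v ∈ Icc (0 : ℝ) 1, JumpEq c x r v := by
  have hβ : 0 ≤ 2 - 2 * r := by linarith [hr.2]
  rcases le_or_gt r (1 / 2) with h | h
  · refine ⟨0, by simp, ?_⟩
    rw [JumpEq, max_eq_left]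
    exact (min_le_left _ _).trans (by linarith)
  rcases le_or_gt (dist x c * (2 - 2 * r)) (r - 1 / 2) with hd | hd
  · refine ⟨2 - 2 * r, ⟨hβ, by linarith⟩, ?_⟩
    rw [JumpEq, min_eq_right (by linarith), max_eq_right hβ]
  · have hpos : 0 < dist x c := by
      by_contra! hneg
      nlinarith
    have hv : dist x c * ((r - 1 / 2) / dist x c) = r - 1 / 2 := mul_div_cancel₀ _ hpos.ne'
    have h0 : 0 ≤ (r - 1 / 2) / dist x c := div_nonneg (by linarith) hpos.le
    have h1 : (r - 1 / 2) / dist x c ≤ 2 - 2 * r := by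
      rw [div_le_iff₀ hpos]; linarith
    refine ⟨(r - 1 / 2) / dist x c, ⟨h0, by linarith⟩, ?_⟩
    rw [JumpEq, hv, add_sub_assoc, add_sub_cancel_right, min_eq_left h1, max_eq_right h0]

theorem slope {a : ℝ} (ha : 0 < a) (hv : JumpEq c x r v) (hw : JumpEq c x (r + a) w)
    (h0 : 0 < v) : v - 2 * a ≤ w := by
  obtain ⟨h1, h2⟩ := hv.bounds_of_pos h0
  by_contra! hlt
  have := mul_nonneg (dist_nonneg (x := x) (y := c)) (show 0 ≤ v - w by linarith)
  rcases min_le_iff.1 hw.min_le with h | h <;> linarith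

end JumpEq

theorem isFlowJump_jump [CompactSpace C] (c : C) :
    IsFlowJump (flow h) (mk h (c, 1 / 2)) (jump h c) where
  isClosed := by
    refine IsCompact.isClosed (IsCompact.image ?_
      ((continuous_mk.comp continuous_fst).prodMk continuous_snd))
    refine ((isCompact_univ.prod isCompact_Icc).prod isCompact_Icc).inter_right ?_
    exact isClosed_eq (by fun_prop) (by fun_prop)
  mem_Icc hv := by
    obtain ⟨x, r, -, -, hv, -⟩ := mem_jump.1 hv
    exact hv
  nonempty z := by
    obtain ⟨x, r, hr, rfl⟩ := exists_mk_eq z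
    have hr := Ico_subset_Icc_self hr
    obtain ⟨v, hv, hj⟩ := JumpEq.exists_solution c x hr
    exact ⟨v, mem_jump.2 ⟨x, r, hr, rfl, hv, hj⟩⟩
  full {v} hv := by
    refine mem_jump.2 ⟨c, 1 / 2, by norm_num, rfl, hv, ?_⟩
    rw [JumpEq, dist_self, zero_mul, sub_zero, add_sub_cancel_right,
      min_eq_left (by linarith [hv.2]), max_eq_right hv.1]
  unique := by
    have aux : ∀ {z : Susp h} {v w : ℝ}, (z, v) ∈ jump h c → (z, w) ∈ jump h c → v < w →
        z = mk h (c, 1 / 2) := by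
      intro z v w hv hw hlt
      obtain ⟨x, r, hr, rfl, -, hjv⟩ := mem_jump.1 hv
      obtain ⟨y, s, hs, hys, -, hjw⟩ := mem_jump.1 hw
      obtain ⟨rfl, rfl⟩ :=
        mk_eq_mk_of_mem_Ioo (hjw.mem_Ioo_of_pos (hjv.nonneg.trans_lt hlt)) hr hys
      obtain ⟨rfl, rfl⟩ := hjv.eq_of_lt hjw hlt
      rfl
    intro z v w hz hv hw
    rcases lt_trichotomy v w with hlt | rfl | hlt
    · exact absurd (aux hv hw hlt) hz
    · rfl
    · exact absurd (aux hw hv hlt) hz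
  slope {z v w a} ha hv hw := by
    obtain ⟨x, r, hr, rfl, -, hv⟩ := mem_jump.1 hv
    obtain ⟨y, s, hs, hys, -, hw⟩ := mem_jump.1 hw
    by_contra! hlt
    have h0 : 0 < v := by linarith [hw.nonneg]
    have hβ := (hv.bounds_of_pos h0).2
    rw [flow_mk] at hys
    obtain ⟨rfl, rfl⟩ := mk_eq_mk_of_mem_Ioo (s := s)
      ⟨by linarith [hr.1], by linarith [hw.nonneg]⟩ hs hys.symm
    linarith [JumpEq.slope ha hv hw h0]

end Jump

end Susp

/-- The suspension of a minimal homeomorphism of an infinite compact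
finite–dimensional metric space is a nondegenerate continuum carrying a
noninvertible minimal map. -/
theorem stmt4 {C : Type*} [MetricSpace C] [CompactSpace C] [Infinite C]
    (hemb : ∃ (d : ℕ) (e : C → (Fin d → ℝ)), IsEmbedding e)
    (h : C ≃ₜ C) (hmin : IsMinimalMap (h : C → C)) :
    CompactSpace (Susp h) ∧ ConnectedSpace (Susp h) ∧ Nontrivial (Susp h) ∧
      TopologicalSpace.MetrizableSpace (Susp h) ∧
      ∃ f : Susp h → Susp h, Continuous f ∧ Function.Surjective f ∧
        IsMinimalMap f ∧ ¬ Function.Injective f := by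
  obtain ⟨t, ht, hflow⟩ : ∃ t > 0, IsMinimalMap (Susp.flow h t) :=
    haveI := Susp.nontrivial (h := h)
    (Susp.flow h).exists_isMinimalMap (Susp.dense_flow hmin)
  obtain ⟨c⟩ : Nonempty C := inferInstance
  obtain ⟨f, hf, hinj⟩ := (Susp.isFlowJump_jump (h := h) c).exists_noninvertible_minimal ht.ne'
    (fun _ => Susp.flow_eq_self hmin) hflow (Susp.dense_compl_flow_line hmin _)
  exact ⟨inferInstance, Susp.connectedSpace hmin, Susp.nontrivial, inferInstance,
    f, hf.1, hf.surjective, hf, hinj⟩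
end

section
/- Let P be a nondegenerate continuum such that no nondegenerate subcontinuum of P is locally connected (for instance, a pseudo-arc). Then the product P × P contains no subspace homeomorphic to the interval [0,1]; in particular, P × P contains no subspace homeomorphic to [0,1] × [0,1] and no subspace homeomorphic to [0,1] × P. -/
open Function Set Topology Filter Metric

/-- A subcontinuum: a nonempty compact connected subset. -/
def IsSubcontinuum {Y : Type*} [TopologicalSpace Y] (A : Set Y) : Prop :=
  IsCompact A ∧ IsConnected A

theorem locallyConnectedSpace_Icc (a b : ℝ) (h : a ≤ b) :
    LocallyConnectedSpace (Set.Icc a b) :=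
  (Topology.IsQuotientMap.of_inverse continuous_subtype_val (continuous_projIcc (h := h))
    (fun x => Set.projIcc_val h x)).isCoinducing.locallyConnectedSpace

theorem locallyConnectedSpace_range {Y P : Type*} [TopologicalSpace Y] [CompactSpace Y]
    [LocallyConnectedSpace Y] [TopologicalSpace P] [T2Space P] {f : Y → P} (hf : Continuous f) :
    LocallyConnectedSpace (Set.range f) :=
  (IsQuotientMap.of_surjective_continuous Set.rangeFactorization_surjective
    hf.rangeFactorization).isCoinducing.locallyConnectedSpace

theorem eq_of_continuous_of_forall_subcontinuum {P : Type*} [TopologicalSpace P] [T2Space P]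
    (hnl : ∀ A : Set P, IsSubcontinuum A → ¬ A.Subsingleton → ¬ LocallyConnectedSpace A)
    {f : Set.Icc (0 : ℝ) 1 → P} (hf : Continuous f) (s t : Set.Icc (0 : ℝ) 1) : f s = f t := by
  have := locallyConnectedSpace_Icc 0 1 zero_le_one
  by_contra hne
  exact hnl (Set.range f) ⟨isCompact_range hf, isConnected_range hf⟩
    (fun h => hne (h ⟨s, rfl⟩ ⟨t, rfl⟩)) (locallyConnectedSpace_range hf)

/-- If no nondegenerate subcontinuum of the nondegenerate continuum `P` is locally
connected, then `P × P` contains no copy of `[0,1]`; in particular it contains no copy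
of `[0,1] × [0,1]` and no copy of `[0,1] × P`. -/
theorem stmt11 {P : Type*} [MetricSpace P] [CompactSpace P] [ConnectedSpace P]
    [Nonempty P] (hP : Nontrivial P)
    (hnl : ∀ A : Set P, IsSubcontinuum A → ¬ A.Subsingleton → ¬ LocallyConnectedSpace A) :
    (∀ A : Set (P × P), ¬ Nonempty (A ≃ₜ Set.Icc (0 : ℝ) 1)) ∧
    (∀ A : Set (P × P), ¬ Nonempty (A ≃ₜ (↥(Set.Icc (0 : ℝ) 1) × ↥(Set.Icc (0 : ℝ) 1)))) ∧
    (∀ A : Set (P × P), ¬ Nonempty (A ≃ₜ (↥(Set.Icc (0 : ℝ) 1) × P))) := by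
  have key (g : ↥(Set.Icc (0 : ℝ) 1) → P × P) (hg : Continuous g) (hinj : Injective g) : False := by
    have h1 := eq_of_continuous_of_forall_subcontinuum hnl (continuous_fst.comp hg) 0 1
    have h2 := eq_of_continuous_of_forall_subcontinuum hnl (continuous_snd.comp hg) 0 1
    exact zero_ne_one (hinj (Prod.ext h1 h2))
  refine ⟨fun A ⟨e⟩ => ?_, fun A ⟨e⟩ => ?_, fun A ⟨e⟩ => ?_⟩
  · exact key (fun t => e.symm t) (by fun_prop) (Subtype.val_injective.comp e.symm.injective)
  · exact key (fun t => e.symm (t, 0)) (by fun_prop)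
      (Subtype.val_injective.comp (e.symm.injective.comp (Prod.mk_left_injective 0)))
  · obtain ⟨p⟩ := ‹Nonempty P›
    exact key (fun t => e.symm (t, p)) (by fun_prop)
      (Subtype.val_injective.comp (e.symm.injective.comp (Prod.mk_left_injective p)))
end

section
/- Let h : X → X be a homeomorphism of a compact metric space X such that for every x ∈ X the full orbit {h^n(x) : n ∈ ℤ} is dense in X. Then h is forward minimal: for every x ∈ X the forward orbit {h^n(x) : n ≥ 0} is dense in X. -/
open Function Set Topology Filter Metric

/-- Every integer power of a homeomorphism is continuous. -/
theorem Homeomorph.continuous_toEquiv_zpow_s14 {X : Type*} [TopologicalSpace X] (h : X ≃ₜ X) (k : ℤ) :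
    Continuous ((h.toEquiv ^ k : Equiv.Perm X) : X → X) := by
  obtain ⟨n, rfl | rfl⟩ := k.eq_nat_or_neg
  · rw [zpow_natCast, Equiv.Perm.coe_pow]
    exact h.continuous.iterate n
  · rw [zpow_neg, zpow_natCast, ← inv_pow, Equiv.Perm.coe_pow]
    exact h.symm.continuous.iterate n

/-- A homeomorphism of a compact metric space all of whose full orbits are dense is
forward minimal: all forward orbits are dense. -/
theorem stmt14 {X : Type*} [MetricSpace X] [CompactSpace X] (h : X ≃ₜ X)
    (hd : ∀ x : X, Dense (Set.range fun n : ℤ => (h.toEquiv ^ n) x)) :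
    ∀ x : X, Dense (Set.range fun n : ℕ => (h : X → X)^[n] x) := by
  intro x
  obtain ⟨y, hy⟩ := exists_clusterPt_of_compactSpace (map (fun n : ℕ => (h : X → X)^[n] x) atTop)
  refine dense_iff_inter_open.2 fun U hU hne => ?_
  obtain ⟨_, hkU, k, rfl⟩ := (hd y).inter_open_nonempty U hU hne
  have hV : ((h.toEquiv ^ k : Equiv.Perm X) : X → X) ⁻¹' U ∈ 𝓝 y :=
    (hU.preimage (h.continuous_toEquiv_zpow_s14 k)).mem_nhds hkU
  obtain ⟨n, hn, hnU⟩ := frequently_atTop.1 (MapClusterPt.frequently hy hV) k.natAbs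
  have key : (h : X → X)^[(k + n).toNat] x = (h.toEquiv ^ k : Equiv.Perm X) ((h : X → X)^[n] x) := by
    have hpow (m : ℕ) : (h : X → X)^[m] x = (h.toEquiv ^ (m : ℤ) : Equiv.Perm X) x := by
      rw [zpow_natCast, Equiv.Perm.coe_pow]
      rfl
    rw [hpow, hpow, Int.toNat_of_nonneg (by omega), zpow_add, Equiv.Perm.mul_apply]
  exact ⟨_, hnU, (k + n).toNat, key⟩
end

section
/- Let φ : M × ℝ → M be a continuous, aperiodic, minimal flow on a nonempty compact metric space M. Then for every y ∈ M and all real numbers a < b, the flow segment {φ(y,t) : t ∈ [a,b]} has empty interior in M. -/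
open Function Set Topology Filter Metric

/-- `φ` is a continuous flow. -/
def IsFlow {M : Type*} [TopologicalSpace M] (φ : M → ℝ → M) : Prop :=
  Continuous (fun p : M × ℝ => φ p.1 p.2) ∧ (∀ x, φ x 0 = x) ∧
    ∀ x s t, φ (φ x s) t = φ x (s + t)

/-- For a continuous aperiodic minimal flow on a nonempty compact metric space, every
flow segment `{φ(y, t) : t ∈ [a, b]}` has empty interior. -/
theorem stmt15 {M : Type*} [MetricSpace M] [CompactSpace M] [Nonempty M]
    (φ : M → ℝ → M) (hflow : IsFlow φ)
    (hmin : ∀ x : M, Dense (Set.range (φ x)))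
    (haper : ∀ x : M, ∀ t : ℝ, φ x t = x → t = 0) :
    ∀ y : M, ∀ a b : ℝ, a < b → interior (φ y '' Set.Icc a b) = ∅ := by
  obtain ⟨hcont, hzero, hadd⟩ := hflow
  have hinj : ∀ (y : M) (s t : ℝ), φ y s = φ y t → s = t := by
    intro y s t h
    have h' := haper y (s - t) (by rw [sub_eq_add_neg, ← hadd, h, hadd, add_neg_cancel, hzero])
    linarith
  intro y a b _
  by_contra hne
  set U := interior (φ y '' Set.Icc a b)
  have hUne : U.Nonempty := Set.nonempty_iff_ne_empty.mpr hne
  obtain ⟨s, hs⟩ := isCompact_univ.elim_finite_subcover (fun t : ℝ => {x : M | φ x t ∈ U})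
    (fun t => isOpen_interior.preimage (hcont.comp (Continuous.prodMk_left t)))
    (fun x _ => by
      obtain ⟨_, hzU, t, rfl⟩ := (hmin x).inter_open_nonempty U isOpen_interior hUne
      exact Set.mem_iUnion.mpr ⟨t, hzU⟩)
  -- A point of the orbit of `y` far enough in time cannot return to the segment by a time in `s`.
  obtain ⟨t, hts, ht⟩ := Set.mem_iUnion₂.mp
    (hs (Set.mem_univ (φ y (b + 1 + ∑ r ∈ s, |r|))))
  obtain ⟨u, hu, hut⟩ := interior_subset ht
  rw [hadd] at hut
  have hle : |t| ≤ ∑ r ∈ s, |r| :=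
    Finset.single_le_sum (f := fun r : ℝ => |r|) (fun r _ => abs_nonneg r) hts
  have hueq := hinj y _ _ hut
  linarith [hu.2, neg_abs_le t]
end

section
/- Let X be a compact metric space and let (P_i)_{i ∈ ℤ} be a family of pairwise disjoint nonempty closed subsets of X such that lim_{|i|→∞} diam(P_i) = 0. Then the relation R on X defined by x R y iff x = y or there exists i ∈ ℤ with x, y ∈ P_i is an equivalence relation whose graph {(x,y) : x R y} is a closed subset of X × X. -/
open Function Set Topology Filter Metric

/-- Being equal or in a common member of a pairwise disjoint family is an equivalence relation. -/
theorem equivalence_eq_or_exists_mem {X ι : Type*} {P : ι → Set X}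
    (hdisj : Pairwise fun i j => Disjoint (P i) (P j)) :
    Equivalence (fun x y : X => x = y ∨ ∃ i, x ∈ P i ∧ y ∈ P i) where
  refl _ := Or.inl rfl
  symm := by
    rintro x y (rfl | ⟨i, hx, hy⟩)
    · exact Or.inl rfl
    · exact Or.inr ⟨i, hy, hx⟩
  trans := by
    rintro x y z (rfl | ⟨i, hx, hy⟩) (rfl | ⟨j, hy', hz⟩)
    · exact Or.inl rfl
    · exact Or.inr ⟨j, hy', hz⟩
    · exact Or.inr ⟨i, hx, hy⟩
    · obtain rfl : i = j := by
        by_contra hij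
        exact Set.disjoint_left.mp (hdisj hij) hy hy'
      exact Or.inr ⟨i, hx, hz⟩

/-- Collapsing the members of a null family of bounded closed sets gives a relation with closed
graph. -/
theorem isClosed_setOf_eq_or_exists_mem {X ι : Type*} [MetricSpace X] {P : ι → Set X}
    (hcl : ∀ i, IsClosed (P i)) (hbdd : ∀ i, Bornology.IsBounded (P i))
    (hdiam : Tendsto (fun i => diam (P i)) cofinite (𝓝 0)) :
    IsClosed {q : X × X | q.1 = q.2 ∨ ∃ i, q.1 ∈ P i ∧ q.2 ∈ P i} := by
  refine isClosed_of_closure_subset fun q hq => ?_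
  by_contra hqS
  simp only [mem_ofPred_eq, not_or, not_exists] at hqS
  have hd : 0 < dist q.1 q.2 := dist_pos.mpr hqS.1
  have hfin : {i | ¬ diam (P i) < dist q.1 q.2 / 2}.Finite :=
    eventually_cofinite.mp (hdiam.eventually_lt_const (half_pos hd))
  have hC : IsClosed ({p : X × X | dist p.1 p.2 ≤ dist q.1 q.2 / 2} ∪
      ⋃ i ∈ {i | ¬ diam (P i) < dist q.1 q.2 / 2}, P i ×ˢ P i) :=
    (isClosed_le (by fun_prop) continuous_const).union
      (hfin.isClosed_biUnion fun i _ => (hcl i).prod (hcl i))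
  have hqC := closure_minimal (fun p hp => ?_) hC hq
  · rcases hqC with h | h
    · simp only [mem_ofPred_eq] at h
      linarith
    · obtain ⟨i, -, hi⟩ := mem_iUnion₂.mp h
      exact hqS.2 i hi
  · rcases hp with h | ⟨i, hi⟩
    · left
      simp only [mem_ofPred_eq, h, dist_self]
      positivity
    · by_cases hlt : diam (P i) < dist q.1 q.2 / 2
      · exact Or.inl ((dist_le_diam_of_mem (hbdd i) hi.1 hi.2).trans hlt.le)
      · exact Or.inr (mem_iUnion₂.mpr ⟨i, hlt, hi⟩)

/-- Gluing along a null family of pairwise disjoint nonempty closed sets yields a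
closed equivalence relation. -/
theorem stmt18 {X : Type*} [MetricSpace X] [CompactSpace X] (P : ℤ → Set X)
    (hne : ∀ i, (P i).Nonempty) (hcl : ∀ i, IsClosed (P i))
    (hdisj : Pairwise fun i j => Disjoint (P i) (P j))
    (hdiam : Filter.Tendsto (fun i : ℤ => Metric.diam (P i))
      (Filter.cocompact ℤ) (nhds 0)) :
    Equivalence (fun x y : X => x = y ∨ ∃ i : ℤ, x ∈ P i ∧ y ∈ P i) ∧
    IsClosed {q : X × X | q.1 = q.2 ∨ ∃ i : ℤ, q.1 ∈ P i ∧ q.2 ∈ P i} := by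
  rw [cocompact_eq_cofinite] at hdiam
  exact ⟨equivalence_eq_or_exists_mem hdisj,
    isClosed_setOf_eq_or_exists_mem hcl (fun i => (hcl i).isCompact.isBounded) hdiam⟩
end
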